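/- arXiv:1312.6311 — 8 statements merged into one kernel-verified Lean document; each statement's English description precedes it below -/
import Mathlib

section
/- Let (X,d) be a pseudometric space and let Ω ⊆ X × ℝ. Then for every h ≥ 0 one has the inclusion (SΩ)^h ⊆ S(Ω^h); that is, the h-neighborhood (with respect to the ℓ²-product distance) of the Steiner symmetrization of Ω is contained in the Steiner symmetrization of the h-neighborhood of Ω. -/
open MeasureTheory

/-- The Steiner symmetrization of `Ω ⊆ X × ℝ`: the set of points `(x,t)` with
`2|t| < λ(Ω_x)`, where `Ω_x` is the slice of `Ω` over `x` and `λ` is Lebesgue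
(outer) measure on `ℝ`. -/
def steinerSymmetrization {X : Type*} (Ω : Set (X × ℝ)) : Set (X × ℝ) :=
  {p : X × ℝ | ENNReal.ofReal (2 * |p.2|) < volume {t : ℝ | (p.1, t) ∈ Ω}}

/-- The `h`-neighborhood of `A ⊆ X × ℝ` with respect to the ℓ²-product distance. -/
def prodNbhd {X : Type*} [PseudoMetricSpace X] (A : Set (X × ℝ)) (h : ℝ) : Set (X × ℝ) :=
  {q : X × ℝ | ∃ p ∈ A, dist p.1 q.1 ^ 2 + (q.2 - p.2) ^ 2 ≤ h ^ 2}

theorem volume_thicken_aux (A B : Set ℝ) (a s : ℝ) (hs : 0 ≤ s) (ha : a ∈ A)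
    (hB : ∀ t ∈ A, ∀ u, |u - t| ≤ s → u ∈ B) :
    volume A + ENNReal.ofReal (2 * s) ≤ volume B := by
  have h1 := measure_inter_add_sdiff (μ := volume) A (measurableSet_Iic (a := a))
  have h2 := measure_inter_add_sdiff (μ := volume) B (measurableSet_Iic (a := a - s))
  have h3 := measure_inter_add_sdiff (μ := volume) (B \ Set.Iic (a - s))
    (measurableSet_Iic (a := a + s))
  have e1 : volume (A ∩ Set.Iic a) ≤ volume (B ∩ Set.Iic (a - s)) := by
    rw [← measure_preimage_add_right volume s (A ∩ Set.Iic a)]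
    apply measure_mono
    rintro u ⟨hu, hu'⟩
    simp only [Set.mem_Iic] at hu'
    refine ⟨hB _ hu u ?_, ?_⟩
    · rw [abs_le]; constructor <;> linarith
    · simp only [Set.mem_Iic]; linarith
  have e2 : volume (A \ Set.Iic a) ≤ volume ((B \ Set.Iic (a - s)) \ Set.Iic (a + s)) := by
    rw [← measure_preimage_add_right volume (-s) (A \ Set.Iic a)]
    apply measure_mono
    rintro u ⟨hu, hu'⟩
    simp only [Set.mem_Iic, not_le] at hu'
    refine ⟨⟨hB _ hu u ?_, ?_⟩, ?_⟩
    · rw [abs_le]; constructor <;> linarith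
    · simp only [Set.mem_Iic, not_le]; linarith
    · simp only [Set.mem_Iic, not_le]; linarith
  have e3 : ENNReal.ofReal (2 * s) ≤ volume ((B \ Set.Iic (a - s)) ∩ Set.Iic (a + s)) := by
    have : ENNReal.ofReal (2 * s) = volume (Set.Ioc (a - s) (a + s)) := by
      rw [Real.volume_Ioc]; congr 1; ring
    rw [this]
    apply measure_mono
    rintro u ⟨hu, hu'⟩
    refine ⟨⟨hB a ha u ?_, ?_⟩, hu'⟩
    · rw [abs_le]; constructor <;> linarith
    · simp only [Set.mem_Iic, not_le]; linarith
  rw [← h1, ← h2, ← h3, add_assoc, add_comm (volume (A \ _))]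
  gcongr

/-- The `h`-neighborhood of the Steiner symmetrization is contained in the Steiner
symmetrization of the `h`-neighborhood. -/
theorem prodNbhd_steinerSymmetrization_subset {X : Type*} [PseudoMetricSpace X]
    (Ω : Set (X × ℝ)) (h : ℝ) (hh : 0 ≤ h) :
    prodNbhd (steinerSymmetrization Ω) h ⊆ steinerSymmetrization (prodNbhd Ω h) := by
  rintro ⟨x', t'⟩ ⟨⟨x, t⟩, hp, hd⟩
  simp only [steinerSymmetrization, Set.mem_setOf_eq] at hp hd ⊢
  obtain ⟨a, ha⟩ : {t : ℝ | (x, t) ∈ Ω}.Nonempty := by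
    rw [Set.nonempty_iff_ne_empty]
    intro h0
    rw [h0] at hp
    simp at hp
  have key := volume_thicken_aux {t : ℝ | (x, t) ∈ Ω} {t : ℝ | (x', t) ∈ prodNbhd Ω h} a
    |t' - t| (abs_nonneg _) ha (by
      intro v hv u hu
      refine ⟨(x, v), hv, ?_⟩
      have := sq_le_sq.mpr hu
      simp only
      linarith)
  refine lt_of_lt_of_le ?_ key
  calc ENNReal.ofReal (2 * |t'|) ≤ ENNReal.ofReal (2 * |t| + 2 * |t' - t|) := by
        apply ENNReal.ofReal_le_ofReal
        have := abs_add_le t (t' - t)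
        rw [add_sub_cancel] at this
        linarith
    _ = ENNReal.ofReal (2 * |t|) + ENNReal.ofReal (2 * |t' - t|) :=
        ENNReal.ofReal_add (by positivity) (by positivity)
    _ < _ := ENNReal.add_lt_add_right ENNReal.ofReal_ne_top hp
end

section
/- Let s₀ > 0 and let f : (−s₀,s₀) → ℝ be differentiable with f > 0 everywhere. Define F(s) = ∫₀ˢ f(t) dt and φ(s) = F(s)/f(s). Let s₁ ∈ (0,s₀) satisfy φ(s₁) > 0 and |φ(s)| < φ(s₁) for all s ∈ (−s₁,s₁). Define u(s) = −∫₀ˢ φ(t)/√(φ(s₁)² − φ(t)²) dt for s ∈ (−s₁,s₁). Then u is twice differentiable on (−s₁,s₁) with u'(s) = −φ(s)/√(φ(s₁)² − φ(s)²), and for every s ∈ (−s₁,s₁) the constant mean curvature equation holds: −u''(s)/(1+u'(s)²)^{3/2} − (u'(s)/√(1+u'(s)²))·(f'(s)/f(s)) = 1/φ(s₁). -/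
open Set MeasureTheory

theorem cmc_aux_ftc (g : ℝ → ℝ) (a : ℝ) (hg : ∀ s ∈ Ioo (-a) a, ContinuousAt g s)
    (s : ℝ) (hs : s ∈ Ioo (-a) a) : HasDerivAt (fun x => ∫ t in (0:ℝ)..x, g t) (g s) s := by
  have h0 : (0:ℝ) ∈ Ioo (-a) a := ⟨by linarith [hs.1, hs.2], by linarith [hs.1, hs.2]⟩
  have hc : ContinuousOn g (Ioo (-a) a) := fun x hx => (hg x hx).continuousWithinAt
  have hsub : uIcc 0 s ⊆ Ioo (-a) a := ordConnected_Ioo.uIcc_subset h0 hs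
  exact intervalIntegral.integral_hasDerivAt_right (hc.mono hsub).intervalIntegrable
    (hc.stronglyMeasurableAtFilter isOpen_Ioo s hs) (hg s hs)

/-- The explicit profile `u(s) = -∫₀ˢ φ/√(φ(s₁)²-φ²)` solves the constant mean curvature
equation `-u''/(1+u'²)^{3/2} - (u'/√(1+u'²))·(f'/f) = 1/φ(s₁)` on `(-s₁,s₁)`,
where `F(s) = ∫₀ˢ f`, `φ = F/f`. -/
theorem cmc_profile_equation
    (s₀ : ℝ) (hs₀ : 0 < s₀) (f : ℝ → ℝ)
    (hf : ∀ s ∈ Ioo (-s₀) s₀, DifferentiableAt ℝ f s)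
    (hfpos : ∀ s ∈ Ioo (-s₀) s₀, 0 < f s)
    (F φ u u' : ℝ → ℝ)
    (hF : ∀ s, F s = ∫ t in (0:ℝ)..s, f t)
    (hφ : ∀ s, φ s = F s / f s)
    (s₁ : ℝ) (hs₁ : s₁ ∈ Ioo 0 s₀) (hφs₁ : 0 < φ s₁)
    (hφlt : ∀ s ∈ Ioo (-s₁) s₁, |φ s| < φ s₁)
    (hu : ∀ s, u s = -∫ t in (0:ℝ)..s, φ t / Real.sqrt (φ s₁ ^ 2 - φ t ^ 2))
    (hu' : ∀ s, u' s = -(φ s / Real.sqrt (φ s₁ ^ 2 - φ s ^ 2))) :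
    ∀ s ∈ Ioo (-s₁) s₁,
      HasDerivAt u (u' s) s ∧ DifferentiableAt ℝ u' s ∧
      -(deriv u' s) / (1 + u' s ^ 2) ^ ((3:ℝ)/2)
        - u' s / Real.sqrt (1 + u' s ^ 2) * (deriv f s / f s) = 1 / φ s₁ := by
  have hFd : ∀ s ∈ Ioo (-s₀) s₀, HasDerivAt F (f s) s := by
    intro s hs
    rw [funext hF]
    exact cmc_aux_ftc f s₀ (fun x hx => (hf x hx).continuousAt) s hs
  have hsub : ∀ s ∈ Ioo (-s₁) s₁, s ∈ Ioo (-s₀) s₀ := fun s hs =>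
    ⟨by linarith [hs.1, hs₁.2], by linarith [hs.2, hs₁.2]⟩
  have hφd : ∀ s ∈ Ioo (-s₁) s₁, HasDerivAt φ (1 - φ s * (deriv f s / f s)) s := by
    intro s hs
    have hs' := hsub s hs
    have hne := (hfpos s hs').ne'
    have h := (hFd s hs').div (hf s hs').hasDerivAt hne
    have e : φ = F / f := funext hφ
    rw [e]
    refine h.congr_deriv ?_
    simp only [Pi.div_apply]
    field_simp
  generalize φ s₁ = c at *
  have hpos : ∀ s ∈ Ioo (-s₁) s₁, 0 < c ^ 2 - φ s ^ 2 := by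
    intro s hs
    have := sq_lt_sq' (abs_lt.1 (hφlt s hs)).1 (abs_lt.1 (hφlt s hs)).2
    linarith
  have hgd : ∀ s ∈ Ioo (-s₁) s₁, HasDerivAt (fun t => φ t / Real.sqrt (c ^ 2 - φ t ^ 2))
      ((1 - φ s * (deriv f s / f s)) * c ^ 2 / Real.sqrt (c ^ 2 - φ s ^ 2) ^ 3) s := by
    intro s hs
    have hp := hpos s hs
    have hR : 0 < Real.sqrt (c ^ 2 - φ s ^ 2) := Real.sqrt_pos.2 hp
    have h := (hφd s hs).fun_div ((((hφd s hs).fun_pow 2).const_sub (c ^ 2)).sqrt hp.ne') hR.ne'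
    refine h.congr_deriv ?_
    have hR2 := Real.sq_sqrt hp.le
    generalize Real.sqrt (c ^ 2 - φ s ^ 2) = R at *
    have hc2 : c ^ 2 = R ^ 2 + φ s ^ 2 := by linarith
    rw [hc2]
    generalize 1 - φ s * (deriv f s / f s) = d
    field_simp
    norm_num
    try ring
  intro s hs
  have hud : HasDerivAt u' (-((1 - φ s * (deriv f s / f s)) * c ^ 2 /
      Real.sqrt (c ^ 2 - φ s ^ 2) ^ 3)) s := by
    rw [funext hu']
    exact (hgd s hs).fun_neg
  refine ⟨?_, hud.differentiableAt, ?_⟩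
  · rw [funext hu, hu']
    exact (cmc_aux_ftc _ s₁ (fun x hx => (hgd x hx).continuousAt) s hs).fun_neg
  · rw [hud.deriv, hu']
    have hp := hpos s hs
    have hR : 0 < Real.sqrt (c ^ 2 - φ s ^ 2) := Real.sqrt_pos.2 hp
    have hR2 := Real.sq_sqrt hp.le
    generalize Real.sqrt (c ^ 2 - φ s ^ 2) = R at *
    have hcR : 0 < c / R := div_pos hφs₁ hR
    have e : 1 + (-(φ s / R)) ^ 2 = (c / R) ^ 2 := by
      field_simp
      linarith
    have e2 : ((c / R) ^ 2) ^ ((3:ℝ)/2) = (c / R) ^ 3 := by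
      rw [← Real.rpow_natCast, ← Real.rpow_mul hcR.le, ← Real.rpow_natCast]
      norm_num
    rw [e, e2, Real.sqrt_sq hcR.le]
    generalize deriv f s / f s = k
    field_simp
    ring
end

section
/- Let s₁ > 0 and let φ : [0,s₁] → ℝ be continuous with 0 ≤ φ(s) < φ(s₁) for every s ∈ [0,s₁). Assume φ is differentiable at s₁ (derivative taken within [0,s₁]) with φ'(s₁) > 0. Then the function t ↦ φ(t)/√(φ(s₁)² − φ(t)²) is integrable on [0,s₁); in particular, the integrals ∫₀ˢ φ(t)/√(φ(s₁)² − φ(t)²) dt converge to a finite limit as s → s₁ from the left. -/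
open Set MeasureTheory Filter

/-- If `0 ≤ φ < φ(s₁)` on `[0,s₁)`, `φ` is continuous on `[0,s₁]` and differentiable at
`s₁` (within `[0,s₁]`) with positive derivative, then `t ↦ φ(t)/√(φ(s₁)²-φ(t)²)` is
integrable on `[0,s₁)`; in particular `∫₀ˢ` of it converges to a finite limit as
`s → s₁⁻`. -/
theorem profile_integral_converges
    (s₁ : ℝ) (hs₁ : 0 < s₁) (φ : ℝ → ℝ)
    (hφc : ContinuousOn φ (Icc 0 s₁))
    (hφ0 : ∀ s ∈ Ico 0 s₁, 0 ≤ φ s ∧ φ s < φ s₁)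
    (d : ℝ) (hd : 0 < d)
    (hφ' : HasDerivWithinAt φ d (Icc 0 s₁) s₁) :
    IntegrableOn (fun t => φ t / Real.sqrt (φ s₁ ^ 2 - φ t ^ 2)) (Ico 0 s₁) ∧
    ∃ L : ℝ, Tendsto (fun s => ∫ t in (0:ℝ)..s, φ t / Real.sqrt (φ s₁ ^ 2 - φ t ^ 2))
      (nhdsWithin s₁ (Iio s₁)) (nhds L) := by
  have hM : 0 < φ s₁ := lt_of_le_of_lt (hφ0 0 ⟨le_rfl, hs₁⟩).1 (hφ0 0 ⟨le_rfl, hs₁⟩).2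
  have hcont : ContinuousOn (fun t => φ t / Real.sqrt (φ s₁ ^ 2 - φ t ^ 2)) (Ico 0 s₁) := by
    have h1 : ContinuousOn φ (Ico 0 s₁) := hφc.mono Ico_subset_Icc_self
    refine h1.div ((continuousOn_const.sub (h1.pow 2)).sqrt) ?_
    intro t ht
    have h := hφ0 t ht
    have : 0 < φ s₁ ^ 2 - φ t ^ 2 := by nlinarith
    exact (Real.sqrt_pos.2 this).ne'
  have hex : ∃ a, 0 ≤ a ∧ a < s₁ ∧ ∀ t ∈ Ioo a s₁, d / 2 * (s₁ - t) ≤ φ s₁ - φ t := by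
    rw [hasDerivWithinAt_iff_tendsto_slope] at hφ'
    have h1 := hφ'.eventually (lt_mem_nhds (half_lt_self hd))
    rw [Icc_sdiff_right, nhdsWithin_Ico_eq_nhdsLT hs₁] at h1
    obtain ⟨l, hl, h2⟩ := (mem_nhdsLT_iff_exists_Ioo_subset).1 h1
    refine ⟨max 0 l, le_max_left _ _, max_lt hs₁ hl, ?_⟩
    intro t ht
    have h3 : d / 2 < slope φ s₁ t := h2 ⟨lt_of_le_of_lt (le_max_right _ _) ht.1, ht.2⟩
    have h5 : 0 < s₁ - t := sub_pos.2 ht.2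
    rw [slope_comm, slope_def_field, lt_div_iff₀ h5] at h3
    exact h3.le
  obtain ⟨a, ha0, ha1, hslope⟩ := hex
  have hint : IntegrableOn (fun t => φ t / Real.sqrt (φ s₁ ^ 2 - φ t ^ 2)) (Ico 0 s₁) := by
    have hsplit : Ico 0 s₁ = Icc 0 a ∪ Ioo a s₁ := (Icc_union_Ioo_eq_Ico ha0 ha1).symm
    rw [hsplit]
    refine IntegrableOn.union ?_ ?_
    · exact (hcont.mono (fun t ht => ⟨ht.1, lt_of_le_of_lt ht.2 ha1⟩)).integrableOn_Icc
    · have hg0 : IntervalIntegrable (fun x : ℝ => x ^ (-(1/2) : ℝ)) volume (s₁ - a) (s₁ - s₁) :=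
        intervalIntegral.intervalIntegrable_rpow' (by norm_num)
      have hg1 : IntervalIntegrable (fun x : ℝ => (s₁ - x) ^ (-(1/2) : ℝ)) volume a s₁ := by
        simpa using hg0.comp_sub_left s₁
      have hg2 := (intervalIntegrable_iff_integrableOn_Ioo_of_le ha1.le).1 hg1
      have hg3 : IntegrableOn (fun x : ℝ => φ s₁ / Real.sqrt (d / 2 * φ s₁) *
          (s₁ - x) ^ (-(1/2) : ℝ)) (Ioo a s₁) := hg2.const_mul _
      refine Integrable.mono' hg3 ?_ ?_
      · exact (hcont.mono (fun t ht => ⟨ha0.trans ht.1.le, ht.2⟩)).aestronglyMeasurable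
          measurableSet_Ioo
      · refine ae_restrict_of_forall_mem measurableSet_Ioo fun t ht => ?_
        have h := hφ0 t ⟨ha0.trans ht.1.le, ht.2⟩
        have h5 : 0 < s₁ - t := sub_pos.2 ht.2
        have h6 := hslope t ht
        have h7 : 0 < d / 2 * φ s₁ := by positivity
        rw [Real.norm_of_nonneg (div_nonneg h.1 (Real.sqrt_nonneg _)),
          Real.rpow_neg h5.le, ← Real.sqrt_eq_rpow, ← div_eq_mul_inv, div_div,
          ← Real.sqrt_mul h7.le]
        refine div_le_div₀ hM.le h.2.le (Real.sqrt_pos.2 (by positivity)) (Real.sqrt_le_sqrt ?_)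
        nlinarith [mul_le_mul_of_nonneg_right h6 hM.le, mul_nonneg (sub_nonneg.2 h.2.le) h.1]
  refine ⟨hint, ∫ t in (0:ℝ)..s₁, φ t / Real.sqrt (φ s₁ ^ 2 - φ t ^ 2), ?_⟩
  have h1 := (intervalIntegrable_iff_integrableOn_Ico_of_le hs₁.le).2 hint
  have h2 := intervalIntegral.continuousOn_primitive_interval' h1 left_mem_uIcc s₁ right_mem_uIcc
  rw [uIcc_of_le hs₁.le] at h2
  have h3 := h2.mono (Ico_subset_Icc_self)
  rw [ContinuousWithinAt, nhdsWithin_Ico_eq_nhdsLT hs₁] at h3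
  exact h3
end

section
/- Let a > 0, c > 0, and let φ̃ : (−a,a) → ℝ be a smooth odd function with 1 + s·φ̃(s) > 0 for all s ∈ (−a,a). Define φ(s) = s + s²·φ̃(s) and f(s) = (c/(1 + s·φ̃(s)))·exp(−∫₀ˢ φ̃(t)/(1 + t·φ̃(t)) dt). Then f is smooth, everywhere positive, even (f(−s) = f(s)), and satisfies f(s)·φ(s) = ∫₀ˢ f(t) dt for all s ∈ (−a,a); that is, φ = F/f where F(s) = ∫₀ˢ f(t) dt. -/
open Set MeasureTheory

/-- Every smooth odd `φ̃` with `1 + s·φ̃(s) > 0` produces, for each `c > 0`, a smooth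
positive even warping function `f(s) = (c/(1+s·φ̃(s)))·exp(-∫₀ˢ φ̃/(1+t·φ̃))` which
satisfies `f·φ = F` for `φ(s) = s + s²·φ̃(s)` and `F(s) = ∫₀ˢ f`. -/
theorem warping_function_from_phi
    (a c : ℝ) (ha : 0 < a) (hc : 0 < c) (φt : ℝ → ℝ)
    (hsmooth : ContDiffOn ℝ (⊤ : ℕ∞) φt (Ioo (-a) a))
    (hodd : ∀ s ∈ Ioo (-a) a, φt (-s) = -φt s)
    (hpos : ∀ s ∈ Ioo (-a) a, 0 < 1 + s * φt s)
    (φ f : ℝ → ℝ)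
    (hφ : ∀ s, φ s = s + s ^ 2 * φt s)
    (hf : ∀ s, f s = (c / (1 + s * φt s)) *
        Real.exp (-∫ t in (0:ℝ)..s, φt t / (1 + t * φt t))) :
    ContDiffOn ℝ (⊤ : ℕ∞) f (Ioo (-a) a) ∧
    (∀ s ∈ Ioo (-a) a, 0 < f s) ∧
    (∀ s ∈ Ioo (-a) a, f (-s) = f s) ∧
    (∀ s ∈ Ioo (-a) a, f s * φ s = ∫ t in (0:ℝ)..s, f t) := by
  have hO : IsOpen (Ioo (-a) a) := isOpen_Ioo
  have h0 : (0:ℝ) ∈ Ioo (-a) a := ⟨by linarith, ha⟩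
  have hsub : ∀ s ∈ Ioo (-a) a, uIcc 0 s ⊆ Ioo (-a) a := fun s hs =>
    (ordConnected_Ioo).uIcc_subset h0 hs
  have hden : ContDiffOn ℝ (⊤ : ℕ∞) (fun t => 1 + t * φt t) (Ioo (-a) a) :=
    contDiffOn_const.add (contDiffOn_id.mul hsmooth)
  have hne : ∀ s ∈ Ioo (-a) a, 1 + s * φt s ≠ 0 := fun s hs => (hpos s hs).ne'
  obtain ⟨g, hg⟩ : ∃ g : ℝ → ℝ, g = fun t => φt t / (1 + t * φt t) := ⟨_, rfl⟩
  have hgs : ContDiffOn ℝ (⊤ : ℕ∞) g (Ioo (-a) a) := by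
    rw [hg]; exact hsmooth.div hden hne
  obtain ⟨G, hG⟩ : ∃ G : ℝ → ℝ, G = fun s => ∫ t in (0:ℝ)..s, g t := ⟨_, rfl⟩
  have hGd : ∀ s ∈ Ioo (-a) a, HasDerivAt G (g s) s := by
    intro s hs
    rw [hG]
    exact intervalIntegral.integral_hasDerivAt_right
      ((hgs.continuousOn.mono (hsub s hs)).intervalIntegrable)
      (hgs.continuousOn.stronglyMeasurableAtFilter hO s hs)
      (hgs.continuousOn.continuousAt (hO.mem_nhds hs))
  have hGs : ContDiffOn ℝ (⊤ : ℕ∞) G (Ioo (-a) a) := by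
    rw [contDiffOn_infty_iff_deriv_of_isOpen hO]
    exact ⟨fun s hs => (hGd s hs).differentiableAt.differentiableWithinAt,
      hgs.congr fun s hs => (hGd s hs).deriv⟩
  have hf' : f = fun s => (c / (1 + s * φt s)) * Real.exp (-G s) := by
    funext s; rw [hf, hG, hg]
  have hfs : ContDiffOn ℝ (⊤ : ℕ∞) f (Ioo (-a) a) := by
    rw [hf']
    exact (contDiffOn_const.div hden hne).mul hGs.neg.exp
  have hGe : ∀ s ∈ Ioo (-a) a, G (-s) = G s := by
    intro s hs
    have h1 : ∫ t in (0:ℝ)..s, g (-t) = ∫ t in (0:ℝ)..s, - g t := by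
      apply intervalIntegral.integral_congr
      intro t ht
      have ht' := hsub s hs ht
      simp only [hg, hodd t ht']
      rw [neg_mul_neg, neg_div]
    rw [intervalIntegral.integral_comp_neg, intervalIntegral.integral_neg,
      intervalIntegral.integral_symm, neg_zero] at h1
    simp only [hG]
    linarith
  refine ⟨hfs, ?_, ?_, ?_⟩
  · intro s hs
    rw [hf]
    exact mul_pos (div_pos hc (hpos s hs)) (Real.exp_pos _)
  · intro s hs
    simp only [hf']
    rw [hGe s hs, hodd s hs, neg_mul_neg]
  · intro s hs
    have hd : ∀ t ∈ uIcc 0 s, HasDerivAt (fun t => c * t * Real.exp (-G t)) (f t) t := by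
      intro t ht
      have ht' := hsub s hs ht
      have h := ((hasDerivAt_id t).const_mul c).mul ((hGd t ht').neg.exp)
      refine h.congr_deriv ?_
      have := hne t ht'
      simp only [hf', hg, id, Pi.neg_apply]
      field_simp
      ring
    rw [intervalIntegral.integral_eq_sub_of_hasDerivAt hd
      ((hfs.continuousOn.mono (hsub s hs)).intervalIntegrable)]
    have := hne s hs
    simp only [hf', hφ]
    field_simp
    ring
end

section
/- Let s₀ > 0 and let f be twice continuously differentiable on an open interval containing [0,s₀], with f(s) > 0 for all s ∈ [0,s₀]. Define F(s) = ∫₀ˢ f(t) dt and φ(s) = F(s)/f(s). If φ'(s₀) = 0, then there exists s ∈ (0,s₀) with f''(s) > 0. -/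
open Set MeasureTheory

/-- If `f` is `C²` and positive on an open interval containing `[0,s₀]`, `F(s) = ∫₀ˢ f`,
`φ = F/f`, and `φ'(s₀) = 0`, then `f'' > 0` somewhere in `(0,s₀)`. -/
theorem second_deriv_pos_somewhere
    (s₀ : ℝ) (hs₀ : 0 < s₀) (a b : ℝ) (ha : a < 0) (hb : s₀ < b)
    (f F φ : ℝ → ℝ)
    (hf : ContDiffOn ℝ 2 f (Ioo a b))
    (hfpos : ∀ s ∈ Icc 0 s₀, 0 < f s)
    (hF : ∀ x, F x = ∫ t in (0:ℝ)..x, f t)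
    (hφ : ∀ x, φ x = F x / f x)
    (hφ' : deriv φ s₀ = 0) :
    ∃ s ∈ Ioo 0 s₀, 0 < deriv (deriv f) s := by
  by_contra! hcon
  have hsub : ∀ s ∈ Icc 0 s₀, s ∈ Ioo a b := fun s hs =>
    ⟨lt_of_lt_of_le ha hs.1, lt_of_le_of_lt hs.2 hb⟩
  have hfc : ContinuousOn f (Ioo a b) := hf.continuousOn
  have hd1 : ∀ s ∈ Ioo a b, HasDerivAt f (deriv f s) s := fun s hs =>
    ((hf.differentiableOn (by norm_num)).differentiableAt (isOpen_Ioo.mem_nhds hs)).hasDerivAt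
  have hf1 : ContDiffOn ℝ 1 (deriv f) (Ioo a b) :=
    hf.deriv_of_isOpen isOpen_Ioo (by norm_num)
  have hd2 : ∀ s ∈ Ioo a b, HasDerivAt (deriv f) (deriv (deriv f) s) s := fun s hs =>
    ((hf1.differentiableOn (by norm_num)).differentiableAt (isOpen_Ioo.mem_nhds hs)).hasDerivAt
  have hFe : F = fun x => ∫ t in (0:ℝ)..x, f t := funext hF
  have hφe : φ = fun x => F x / f x := funext hφ
  have h0 : (0:ℝ) ∈ Ioo a b := ⟨ha, hs₀.trans hb⟩
  have hFd : ∀ s ∈ Ioo a b, HasDerivAt F (f s) s := by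
    intro s hs
    rw [hFe]
    refine intervalIntegral.integral_hasDerivAt_right ?_ ?_ ?_
    · exact (hfc.mono (ordConnected_Ioo.uIcc_subset h0 hs)).intervalIntegrable
    · exact hfc.stronglyMeasurableAtFilter isOpen_Ioo s hs
    · exact hfc.continuousAt (isOpen_Ioo.mem_nhds hs)
  have hF0 : F 0 = 0 := by simp [hF]
  have hFm : MonotoneOn F (Icc 0 s₀) := by
    refine monotoneOn_of_deriv_nonneg (convex_Icc _ _)
      (fun s hs => (hFd s (hsub s hs)).continuousAt.continuousWithinAt)
      (fun s hs => (hFd s (hsub s (interior_subset hs))).differentiableAt.differentiableWithinAt)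
      (fun s hs => ?_)
    rw [(hFd s (hsub s (interior_subset hs))).deriv]
    exact (hfpos s (interior_subset hs)).le
  have l0 : (0:ℝ) ∈ Icc 0 s₀ := ⟨le_rfl, hs₀.le⟩
  have r0 : s₀ ∈ Icc 0 s₀ := ⟨hs₀.le, le_rfl⟩
  have hFnn : ∀ s ∈ Icc 0 s₀, 0 ≤ F s := fun s hs => hF0 ▸ hFm l0 hs hs.1
  have hanti : AntitoneOn (deriv f) (Icc 0 s₀) := by
    refine antitoneOn_of_deriv_nonpos (convex_Icc _ _)
      (fun s hs => (hd2 s (hsub s hs)).continuousAt.continuousWithinAt)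
      (fun s hs => (hd2 s (hsub s (interior_subset hs))).differentiableAt.differentiableWithinAt)
      (fun s hs => ?_)
    rw [interior_Icc] at hs
    exact hcon s hs
  have hp := hfpos s₀ r0
  have key : f s₀ * f s₀ - F s₀ * deriv f s₀ = 0 := by
    have := ((hFd s₀ (hsub _ r0)).fun_div (hd1 s₀ (hsub _ r0)) hp.ne').deriv
    rw [← hφe, hφ'] at this
    have h2 := (div_eq_zero_iff.mp this.symm)
    exact h2.resolve_right (by positivity)
  have hdpos : 0 ≤ deriv f s₀ := by
    by_contra! h
    nlinarith [hFnn s₀ r0, mul_pos hp hp]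
  have hG : ∀ s ∈ Icc 0 s₀, HasDerivAt (fun s => f s * f s - F s * deriv f s)
      (deriv f s * f s + f s * deriv f s - (f s * deriv f s + F s * deriv (deriv f) s)) s :=
    fun s hs => ((hd1 s (hsub s hs)).fun_mul (hd1 s (hsub s hs))).fun_sub
      ((hFd s (hsub s hs)).fun_mul (hd2 s (hsub s hs)))
  have hGm : MonotoneOn (fun s => f s * f s - F s * deriv f s) (Icc 0 s₀) := by
    refine monotoneOn_of_deriv_nonneg (convex_Icc _ _)
      (fun s hs => (hG s hs).continuousAt.continuousWithinAt)
      (fun s hs => (hG s (interior_subset hs)).differentiableAt.differentiableWithinAt)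
      (fun s hs => ?_)
    have hs' := interior_subset hs
    rw [(hG s hs').deriv]
    rw [interior_Icc] at hs
    have h1 := hdpos.trans (hanti hs' r0 hs'.2)
    have h2 := mul_nonneg (hfpos s hs').le h1
    have h3 := mul_nonneg (hFnn s hs') (neg_nonneg.mpr (hcon s hs))
    nlinarith
  have hfin := hGm l0 r0 hs₀.le
  simp only [hF0, key] at hfin
  nlinarith [mul_pos (hfpos 0 l0) (hfpos 0 l0)]
end

section
/- Let a < b be real numbers, let A be continuously differentiable on [a,b], let B be continuous on [a,b], and let γ, g₁ be twice continuously differentiable on [a,b]. Then ∫ₐᵇ ( A(s)·((γ·g₁)'(s))² + B(s)·(γ(s)·g₁(s))² ) ds = ∫ₐᵇ g₁(s)²·γ(s)·( B(s)·γ(s) − (A·γ')'(s) ) ds + ∫ₐᵇ A(s)·γ(s)²·(g₁'(s))² ds + A(b)·γ'(b)·γ(b)·g₁(b)² − A(a)·γ'(a)·γ(a)·g₁(a)². -/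
open Set MeasureTheory intervalIntegral

/-- One-dimensional index-form substitution lemma: for a test function `γ·g₁` against the
weighted quadratic form `∫ (A·g'² + B·g²)`, one gets a ground-state term, a positive
gradient term, and boundary terms. Here `A'`, `γ'`, `γ''`, `g₁'`, `g₁''` denote the
derivatives of `A`, `γ`, `g₁` on `[a,b]`. -/
theorem index_form_substitution
    (a b : ℝ) (hab : a < b)
    (A A' B γ γ' γ'' g₁ g₁' g₁'' : ℝ → ℝ)
    (hA : ∀ s ∈ Icc a b, HasDerivWithinAt A (A' s) (Icc a b) s)
    (hA' : ContinuousOn A' (Icc a b))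
    (hB : ContinuousOn B (Icc a b))
    (hγ : ∀ s ∈ Icc a b, HasDerivWithinAt γ (γ' s) (Icc a b) s)
    (hγ' : ∀ s ∈ Icc a b, HasDerivWithinAt γ' (γ'' s) (Icc a b) s)
    (hγ'' : ContinuousOn γ'' (Icc a b))
    (hg : ∀ s ∈ Icc a b, HasDerivWithinAt g₁ (g₁' s) (Icc a b) s)
    (hg' : ∀ s ∈ Icc a b, HasDerivWithinAt g₁' (g₁'' s) (Icc a b) s)
    (hg'' : ContinuousOn g₁'' (Icc a b)) :
    ∫ s in a..b, (A s * (γ' s * g₁ s + γ s * g₁' s) ^ 2 + B s * (γ s * g₁ s) ^ 2)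
      = (∫ s in a..b, g₁ s ^ 2 * γ s * (B s * γ s - (A' s * γ' s + A s * γ'' s)))
        + (∫ s in a..b, A s * γ s ^ 2 * g₁' s ^ 2)
        + A b * γ' b * γ b * g₁ b ^ 2 - A a * γ' a * γ a * g₁ a ^ 2 := by
  have cA : ContinuousOn A (Icc a b) := fun s hs => (hA s hs).continuousWithinAt
  have cγ : ContinuousOn γ (Icc a b) := fun s hs => (hγ s hs).continuousWithinAt
  have cγ' : ContinuousOn γ' (Icc a b) := fun s hs => (hγ' s hs).continuousWithinAt
  have cg : ContinuousOn g₁ (Icc a b) := fun s hs => (hg s hs).continuousWithinAt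
  have cg' : ContinuousOn g₁' (Icc a b) := fun s hs => (hg' s hs).continuousWithinAt
  have hu : uIcc a b = Icc a b := uIcc_of_le hab.le
  have i1 : IntervalIntegrable
      (fun s => g₁ s ^ 2 * γ s * (B s * γ s - (A' s * γ' s + A s * γ'' s))) volume a b := by
    apply ContinuousOn.intervalIntegrable
    rw [hu]
    fun_prop
  have i2 : IntervalIntegrable (fun s => A s * γ s ^ 2 * g₁' s ^ 2) volume a b := by
    apply ContinuousOn.intervalIntegrable
    rw [hu]
    fun_prop
  have i3 : IntervalIntegrable (fun s => (A' s * γ' s + A s * γ'' s) * γ s * g₁ s ^ 2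
      + A s * γ' s ^ 2 * g₁ s ^ 2 + 2 * A s * γ' s * γ s * g₁ s * g₁' s) volume a b := by
    apply ContinuousOn.intervalIntegrable
    rw [hu]
    fun_prop
  have ftc := integral_eq_sub_of_hasDerivAt_of_le hab.le
    (f := fun s => A s * γ' s * γ s * g₁ s ^ 2) (by fun_prop) (fun s hs => by
      have hn : Icc a b ∈ nhds s := Icc_mem_nhds hs.1 hs.2
      have hs' := Ioo_subset_Icc_self hs
      have h := ((((hA s hs').hasDerivAt hn).mul ((hγ' s hs').hasDerivAt hn)).mul
        ((hγ s hs').hasDerivAt hn)).mul (((hg s hs').hasDerivAt hn).pow 2)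
      refine HasDerivAt.congr_deriv (f := fun s => A s * γ' s * γ s * g₁ s ^ 2) h
        (g' := (A' s * γ' s + A s * γ'' s) * γ s * g₁ s ^ 2
      + A s * γ' s ^ 2 * g₁ s ^ 2 + 2 * A s * γ' s * γ s * g₁ s * g₁' s) ?_
      simp only [Pi.mul_apply, Pi.pow_apply]
      push_cast
      ring) i3
  rw [add_sub_assoc, ← ftc, ← integral_add i1 i2, ← integral_add (i1.add i2) i3]
  apply integral_congr
  intro s _
  simp only
  ring
end

section
/- Let f be twice differentiable and positive on an open interval I containing 0, let F(s) = ∫₀ˢ f(t) dt, φ = F/f, and fix b > 0. For s ∈ I with |φ(s)| < b set ψ(s) = √(b² − φ(s)²), A(s) = f(s)·ψ(s), and B(s) = f(s)·(−φ(s)·φ''(s) − φ'(s))/ψ(s). Then for every such s, the function A·ψ' (which equals −f·φ·φ') is differentiable at s with derivative (A·ψ')'(s) = B(s)·ψ(s); that is, ψ solves the Jacobi-type equation (Aψ')' = Bψ on {|φ| < b}. -/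
open Set MeasureTheory

/-- The Killing-field component `ψ = √(b² - φ²)` solves the Jacobi-type equation
`(Aψ')' = Bψ` on `{|φ| < b}`, where `F(s) = ∫₀ˢ f`, `φ = F/f`, `A = f·ψ` and
`B = f·(-φ·φ'' - φ')/ψ`; here `A·ψ'` equals `-f·φ·φ'`. -/
theorem killing_component_solves_jacobi
    (a₁ a₂ : ℝ) (ha₁ : a₁ < 0) (ha₂ : 0 < a₂)
    (f F φ ψ A B : ℝ → ℝ) (b : ℝ) (hb : 0 < b)
    (hf1 : ∀ s ∈ Ioo a₁ a₂, DifferentiableAt ℝ f s)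
    (hf2 : ∀ s ∈ Ioo a₁ a₂, DifferentiableAt ℝ (deriv f) s)
    (hfpos : ∀ s ∈ Ioo a₁ a₂, 0 < f s)
    (hF : ∀ x, F x = ∫ t in (0:ℝ)..x, f t)
    (hφ : ∀ x, φ x = F x / f x)
    (hψ : ∀ x, ψ x = Real.sqrt (b ^ 2 - φ x ^ 2))
    (hA : ∀ x, A x = f x * ψ x)
    (hB : ∀ x, B x = f x * (-φ x * deriv (deriv φ) x - deriv φ x) / ψ x) :
    ∀ s ∈ Ioo a₁ a₂, |φ s| < b →
      A s * deriv ψ s = -(f s * φ s * deriv φ s) ∧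
      HasDerivAt (fun x => -(f x * φ x * deriv φ x)) (B s * ψ s) s := by
  have hcont : ContinuousOn f (Ioo a₁ a₂) :=
    fun x hx => (hf1 x hx).continuousAt.continuousWithinAt
  have hF' : ∀ s ∈ Ioo a₁ a₂, HasDerivAt F (f s) s := by
    intro s hs
    have e : F = fun x => ∫ t in (0:ℝ)..x, f t := funext hF
    rw [e]
    refine intervalIntegral.integral_hasDerivAt_right ?_
      (hcont.stronglyMeasurableAtFilter isOpen_Ioo s hs) (hf1 s hs).continuousAt
    apply ContinuousOn.intervalIntegrable
    exact hcont.mono (ordConnected_Ioo.uIcc_subset ⟨ha₁, ha₂⟩ hs)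
  have hφ' : ∀ s ∈ Ioo a₁ a₂, HasDerivAt φ ((f s * f s - F s * deriv f s) / f s ^ 2) s := by
    intro s hs
    have e : φ = fun x => F x / f x := funext hφ
    rw [e]
    exact (hF' s hs).fun_div (hf1 s hs).hasDerivAt (hfpos s hs).ne'
  intro s hs hlt
  have hfs := (hfpos s hs).ne'
  have hpos : 0 < b ^ 2 - φ s ^ 2 := by
    have := sq_lt_sq.2 (hlt.trans_le (le_abs_self b))
    linarith
  have hψs : 0 < ψ s := by rw [hψ]; exact Real.sqrt_pos.2 hpos
  have hn : Ioo a₁ a₂ ∈ nhds s := isOpen_Ioo.mem_nhds hs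
  have hφd : HasDerivAt φ (deriv φ s) s := (hφ' s hs).differentiableAt.hasDerivAt
  constructor
  · have h1 : HasDerivAt ψ (-(2 * φ s * deriv φ s) / (2 * ψ s)) s := by
      have e : ψ = fun x => Real.sqrt (b ^ 2 - φ x ^ 2) := funext hψ
      have := ((hφd.fun_pow 2).const_sub (b ^ 2)).sqrt hpos.ne'
      rw [← hψ s, ← e] at this
      convert this using 1
      simp
    rw [h1.deriv, hA]
    field_simp
  · have h2 : DifferentiableAt ℝ (deriv φ) s := by
      have e : deriv φ =ᶠ[nhds s] fun x => (f x * f x - F x * deriv f x) / f x ^ 2 := by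
        filter_upwards [hn] with x hx using (hφ' x hx).deriv
      refine DifferentiableAt.congr_of_eventuallyEq ?_ e
      have d1 := hf1 s hs
      have d2 := hf2 s hs
      have d3 := (hF' s hs).differentiableAt
      exact ((d1.fun_mul d1).fun_sub (d3.fun_mul d2)).fun_div (d1.fun_pow 2) (pow_ne_zero 2 hfs)
    have h3 := ((hF' s hs).fun_mul h2.hasDerivAt).fun_neg
    have e : (fun x => -(f x * φ x * deriv φ x)) =ᶠ[nhds s] fun x => -(F x * deriv φ x) := by
      filter_upwards [hn] with x hx
      have := (hfpos x hx).ne'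
      rw [hφ x, mul_div_cancel₀ _ this]
    refine (h3.congr_of_eventuallyEq e).congr_deriv ?_
    have hFs : F s = f s * φ s := by rw [hφ s, mul_div_cancel₀ _ hfs]
    rw [hB, hFs, div_mul_cancel₀ _ hψs.ne']
    ring
end

section
/- Let f be twice differentiable and positive on an open interval I containing 0, let F(s) = ∫₀ˢ f(t) dt, φ = F/f, and fix b > 0. For s ∈ I with |φ(s)| < b set ψ(s) = √(b² − φ(s)²), A(s) = f(s)·ψ(s), and B(s) = f(s)·(−φ(s)·φ''(s) − φ'(s))/ψ(s). Then for every such s, the function A·φ' is differentiable at s with (A·φ')'(s) = B(s)·φ(s) − b²·(f(s)·φ(s)/ψ(s))·( f''(s)/f(s) − (f'(s)/f(s))² ); that is, (Aφ')' = Bφ − (b² f φ/ψ)·(log f)''. -/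
open Set MeasureTheory

/-- `φ` is a subsolution of the Jacobi-type equation when `(log f)'' > 0`:
`(Aφ')' = Bφ - (b²fφ/ψ)·(log f)''`, where `F(s) = ∫₀ˢ f`, `φ = F/f`,
`ψ = √(b² - φ²)`, `A = f·ψ` and `B = f·(-φ·φ'' - φ')/ψ`. -/
theorem phi_jacobi_identity
    (a₁ a₂ : ℝ) (ha₁ : a₁ < 0) (ha₂ : 0 < a₂)
    (f F φ ψ A B : ℝ → ℝ) (b : ℝ) (hb : 0 < b)
    (hf1 : ∀ s ∈ Ioo a₁ a₂, DifferentiableAt ℝ f s)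
    (hf2 : ∀ s ∈ Ioo a₁ a₂, DifferentiableAt ℝ (deriv f) s)
    (hfpos : ∀ s ∈ Ioo a₁ a₂, 0 < f s)
    (hF : ∀ x, F x = ∫ t in (0:ℝ)..x, f t)
    (hφ : ∀ x, φ x = F x / f x)
    (hψ : ∀ x, ψ x = Real.sqrt (b ^ 2 - φ x ^ 2))
    (hA : ∀ x, A x = f x * ψ x)
    (hB : ∀ x, B x = f x * (-φ x * deriv (deriv φ) x - deriv φ x) / ψ x) :
    ∀ s ∈ Ioo a₁ a₂, |φ s| < b →
      HasDerivAt (fun x => A x * deriv φ x)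
        (B s * φ s - b ^ 2 * (f s * φ s / ψ s) *
          (deriv (deriv f) s / f s - (deriv f s / f s) ^ 2)) s := by
  intro s hs hlt
  have hcont : ContinuousOn f (Ioo a₁ a₂) := fun x hx => (hf1 x hx).continuousAt.continuousWithinAt
  have h0 : (0:ℝ) ∈ Ioo a₁ a₂ := ⟨ha₁, ha₂⟩
  have hFd : ∀ x ∈ Ioo a₁ a₂, HasDerivAt F (f x) x := by
    intro x hx
    have hFe : F = fun u => ∫ t in (0:ℝ)..u, f t := funext hF
    rw [hFe]
    apply intervalIntegral.integral_hasDerivAt_right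
    · apply ContinuousOn.intervalIntegrable
      exact hcont.mono (ordConnected_Ioo.uIcc_subset h0 hx)
    · exact hcont.stronglyMeasurableAtFilter isOpen_Ioo x hx
    · exact (hf1 x hx).continuousAt
  have hφd : ∀ x ∈ Ioo a₁ a₂, HasDerivAt φ (1 - φ x * (deriv f x / f x)) x := by
    intro x hx
    have hne := (hfpos x hx).ne'
    have hφe : φ = fun u => F u / f u := funext hφ
    have h := (hFd x hx).div (hf1 x hx).hasDerivAt hne
    have h2 : HasDerivAt φ ((f x * f x - F x * deriv f x) / f x ^ 2) x := by
      rw [hφe]; exact h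
    convert h2 using 1
    rw [hφ x]
    field_simp
  have hne := (hfpos s hs).ne'
  have hev : deriv φ =ᶠ[nhds s] fun x => 1 - φ x * (deriv f x / f x) := by
    filter_upwards [isOpen_Ioo.mem_nhds hs] with x hx using (hφd x hx).deriv
  have hφ1 : deriv φ s = 1 - φ s * (deriv f s / f s) := (hφd s hs).deriv
  have hg := (hf2 s hs).hasDerivAt.div (hf1 s hs).hasDerivAt hne
  have hφ2 := (((hφd s hs).mul hg).const_sub 1).congr_of_eventuallyEq hev
  have hpos : 0 < b ^ 2 - φ s ^ 2 := by
    have := abs_lt.mp hlt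
    nlinarith
  have hψpos : 0 < ψ s := by rw [hψ]; exact Real.sqrt_pos.mpr hpos
  have hψsq : ψ s ^ 2 = b ^ 2 - φ s ^ 2 := by rw [hψ]; exact Real.sq_sqrt hpos.le
  have hψd := (((hφd s hs).pow 2).const_sub (b ^ 2)).sqrt hpos.ne'
  have hψe : ψ = fun x => Real.sqrt (b ^ 2 - φ x ^ 2) := funext hψ
  have hψd' : HasDerivAt ψ (-(φ s * (1 - φ s * (deriv f s / f s))) / ψ s) s := by
    rw [hψe]
    refine hψd.congr_deriv ?_
    have := hψpos.ne'
    rw [hψ] at this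
    simp only [Pi.pow_apply]
    field_simp
    norm_num
    ring
  have hAe : A = fun x => f x * ψ x := funext hA
  have hAd : HasDerivAt A (deriv f s * ψ s + f s * (-(φ s * (1 - φ s * (deriv f s / f s))) / ψ s)) s := by
    rw [hAe]; exact (hf1 s hs).hasDerivAt.mul hψd'
  refine (hAd.mul hφ2).congr_deriv ?_
  rw [hB, hφ2.deriv, hφ1, hA]
  have hb2 : b ^ 2 = ψ s ^ 2 + φ s ^ 2 := by linarith
  rw [hb2]
  have := hψpos.ne'
  simp only [Pi.div_apply]
  generalize deriv (deriv f) s = f2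
  generalize deriv f s = f1
  field_simp
  ring
end
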